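/- Let φ : M × Σ → ℝ be a Hörmander-type phase function satisfying Bourgain's condition, parameterized so that ℓ_{ξ,v} = {(X(ξ,v,t),t) : |t| ≤ 1} with X smooth. Then for each (ξ₀,v₀) ∈ Σ × 𝒱 there exist a smooth map F : M → ℝⁿ which is a local diffeomorphism, a smooth local diffeomorphism Ξ : Σ → ℝ^{n−1}, a smooth map V : Σ × 𝒱 → ℝ^{n−1}, a constant C > 0, and a compact neighborhood K of (ξ₀,v₀) in Σ × 𝒱 such that for every (ξ,v) ∈ K, every point of F(ℓ_{ξ,v}) lies within distance C·|(ξ,v) − (ξ₀,v₀)|² of the line line_{Ξ(ξ), V(ξ,v)}. -/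

import Mathlib

open Metric Set Topology MeasureTheory

noncomputable section

/-- ξ-gradient ∇_ξφ(x,ξ). -/
def gradXi (n : ℕ) (φ : (Fin n → ℝ) → (Fin (n-1) → ℝ) → ℝ)
    (x : Fin n → ℝ) (ξ : Fin (n-1) → ℝ) : Fin (n-1) → ℝ :=
  fun j => fderiv ℝ (φ x) ξ (Pi.single j (1:ℝ))

/-- ξ-Hessian ∇_ξ²φ(x,ξ). -/
def hessXi (n : ℕ) (φ : (Fin n → ℝ) → (Fin (n-1) → ℝ) → ℝ)
    (x : Fin n → ℝ) (ξ : Fin (n-1) → ℝ) : Matrix (Fin (n-1)) (Fin (n-1)) ℝ :=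
  Matrix.of fun i j => fderiv ℝ (fun η => gradXi n φ x η i) ξ (Pi.single j (1:ℝ))

/-- Mixed Hessian ∇_x∇_ξφ(x,ξ) : entry (i,j) is ∂_{x_i}∂_{ξ_j}φ. -/
def mixedHess (n : ℕ) (φ : (Fin n → ℝ) → (Fin (n-1) → ℝ) → ℝ)
    (x : Fin n → ℝ) (ξ : Fin (n-1) → ℝ) : Matrix (Fin n) (Fin (n-1)) ℝ :=
  Matrix.of fun i j => fderiv ℝ (fun y => gradXi n φ y ξ j) x (Pi.single i (1:ℝ))

/-- Gauss map: G(x,ξ)ᵢ = det(∂_{ξ_1}∇_xφ, …, ∂_{ξ_{n-1}}∇_xφ, eᵢ), so that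
⟨G(x,ξ), w⟩ = det(∂_{ξ_1}∇_xφ, …, ∂_{ξ_{n-1}}∇_xφ, w) for all w. -/
def gaussMap (n : ℕ) (φ : (Fin n → ℝ) → (Fin (n-1) → ℝ) → ℝ)
    (x : Fin n → ℝ) (ξ : Fin (n-1) → ℝ) : Fin n → ℝ :=
  fun i => Matrix.det (Matrix.of fun a b : Fin n =>
    if h : (b : ℕ) < n - 1 then mixedHess n φ x ξ a ⟨(b : ℕ), h⟩
    else (Pi.single i (1:ℝ) : Fin n → ℝ) a)

/-- Directional derivative (G(x,ξ)·∇_x) f at x. -/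
def GD (n : ℕ) (φ : (Fin n → ℝ) → (Fin (n-1) → ℝ) → ℝ)
    (f : (Fin n → ℝ) → ℝ) (ξ : Fin (n-1) → ℝ) (x : Fin n → ℝ) : ℝ :=
  fderiv ℝ f x (gaussMap n φ x ξ)

/-- The matrix (G(x,ξ)·∇_x)∇_ξ²φ(x,ξ). -/
def GDhess (n : ℕ) (φ : (Fin n → ℝ) → (Fin (n-1) → ℝ) → ℝ)
    (x : Fin n → ℝ) (ξ : Fin (n-1) → ℝ) : Matrix (Fin (n-1)) (Fin (n-1)) ℝ :=
  Matrix.of fun i j => GD n φ (fun y => hessXi n φ y ξ i j) ξ x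

/-- The matrix (G(x,ξ)·∇_x)²∇_ξ²φ(x,ξ). -/
def GD2hess (n : ℕ) (φ : (Fin n → ℝ) → (Fin (n-1) → ℝ) → ℝ)
    (x : Fin n → ℝ) (ξ : Fin (n-1) → ℝ) : Matrix (Fin (n-1)) (Fin (n-1)) ℝ :=
  Matrix.of fun i j => GD n φ (fun y => GD n φ (fun z => hessXi n φ z ξ i j) ξ y) ξ x

/-- Bourgain's condition on M × Σ. -/
def BourgainCond (n : ℕ) (φ : (Fin n → ℝ) → (Fin (n-1) → ℝ) → ℝ)
    (M : Set (Fin n → ℝ)) (Ω : Set (Fin (n-1) → ℝ)) : Prop :=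
  ∃ lam : (Fin n → ℝ) → (Fin (n-1) → ℝ) → ℝ,
    ∀ x ∈ M, ∀ ξ ∈ Ω, GD2hess n φ x ξ = lam x ξ • GDhess n φ x ξ

/-- Hörmander-type phase function: smooth, (H1) and (H2) on M × Σ. -/
def IsHormander (n : ℕ) (φ : (Fin n → ℝ) → (Fin (n-1) → ℝ) → ℝ)
    (M : Set (Fin n → ℝ)) (Ω : Set (Fin (n-1) → ℝ)) : Prop :=
  ContDiffOn ℝ (⊤ : ℕ∞) (fun q : (Fin n → ℝ) × (Fin (n-1) → ℝ) => φ q.1 q.2) (M ×ˢ Ω) ∧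
  (∀ x ∈ M, ∀ ξ ∈ Ω, (mixedHess n φ x ξ).rank = n - 1) ∧
  (∀ x ∈ M, ∀ ξ ∈ Ω, (GDhess n φ x ξ).det ≠ 0)

/-- The point (x̄, t) ∈ ℝⁿ. -/
def toPt (n : ℕ) (xb : Fin (n-1) → ℝ) (t : ℝ) : Fin n → ℝ :=
  fun i => if h : (i : ℕ) < n - 1 then xb ⟨(i : ℕ), h⟩ else t

/-- line_{ξ,v} = {(v,0) − s(ξ,1) : s ∈ ℝ} ⊆ ℝⁿ. -/
def lineSet (n : ℕ) (ξ v : Fin (n-1) → ℝ) : Set (Fin n → ℝ) :=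
  {p | ∃ s : ℝ, p = toPt n v 0 - s • toPt n ξ 1}

end

/-- A smooth map on an open set has a quadratic first-order Taylor remainder, uniformly along a
compact subset. -/
theorem exists_taylor_bound {E F : Type*} [NormedAddCommGroup E] [NormedSpace ℝ E]
    [ProperSpace E] [NormedAddCommGroup F] [NormedSpace ℝ F] {f : E → F} {U S : Set E}
    (hU : IsOpen U) (hf : ContDiffOn ℝ 2 f U) (hS : IsCompact S) (hSU : S ⊆ U) :
    ∃ ε > 0, ∃ C : ℝ, 0 ≤ C ∧ ∀ p ∈ S, ∀ q, dist q p ≤ ε →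
      ‖f q - f p - fderiv ℝ f p (q - p)‖ ≤ C * ‖q - p‖ ^ 2 := by
  obtain ⟨ε, hε, hεU⟩ := hS.exists_cthickening_subset_open hU hSU
  have hK : IsCompact (cthickening ε S) := hS.cthickening
  have hLip : LocallyLipschitzOn (cthickening ε S) (fderiv ℝ f) := by
    intro x hx
    have h1 : ContDiffAt ℝ 1 (fderiv ℝ f) x :=
      (hf.contDiffAt (hU.mem_nhds (hεU hx))).fderiv_right (by norm_num)
    obtain ⟨K, t, ht, hK⟩ := h1.exists_lipschitzOnWith
    exact ⟨K, t, mem_nhdsWithin_of_mem_nhds ht, hK⟩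
  obtain ⟨L, hL⟩ := hLip.exists_lipschitzOnWith_of_compact hK
  refine ⟨ε, hε, L, L.2, fun p hp q hq => ?_⟩
  have hsub : closedBall p ‖q - p‖ ⊆ cthickening ε S := fun x hx =>
    closedBall_subset_cthickening hp ε
      (closedBall_subset_closedBall (by rwa [← dist_eq_norm]) hx)
  have hpS : p ∈ cthickening ε S := self_subset_cthickening S hp
  have := Convex.norm_image_sub_le_of_norm_fderiv_le' (f := f) (𝕜 := ℝ)
    (C := L * ‖q - p‖) (φ := fderiv ℝ f p) (s := closedBall p ‖q - p‖) (x := p) (y := q)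
    (fun x hx => (hf.contDiffAt (hU.mem_nhds (hεU (hsub hx)))).differentiableAt (by norm_num))
    (fun x hx => by
      have h := hL.dist_le_mul x (hsub hx) p hpS
      rw [dist_eq_norm] at h
      exact h.trans (mul_le_mul_of_nonneg_left (mem_closedBall.1 hx) L.2))
    (convex_closedBall _ _) (by simp) (by simp [dist_eq_norm])
  exact this.trans_eq (by ring)

/-- Smooth local extensions of a function on an interval glue to a global smooth extension. -/
theorem exists_contDiff_eqOn_Icc {E : Type*} [NormedAddCommGroup E] [NormedSpace ℝ E]
    {f : ℝ → E} {a b : ℝ}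
    (h : ∀ t ∈ Icc a b, ∃ U ∈ 𝓝 t, ∃ g : ℝ → E, ContDiffOn ℝ (⊤ : ℕ∞) g U ∧
      ∀ s ∈ U, s ∈ Icc a b → g s = f s) :
    ∃ g : ℝ → E, ContDiff ℝ (⊤ : ℕ∞) g ∧ EqOn g f (Icc a b) := by
  classical
  obtain ⟨g, hg⟩ := exists_contMDiffMap_forall_mem_convex_of_local (n := (⊤ : ℕ∞))
    (modelWithCornersSelf ℝ ℝ) (F := E)
    (t := fun s : ℝ => if s ∈ Icc a b then {f s} else univ)
    (fun s => by split_ifs; exacts [convex_singleton _, convex_univ])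
    (fun t => by
      by_cases ht : t ∈ Icc a b
      · obtain ⟨U, hU, g, hg, hgf⟩ := h t ht
        refine ⟨U, hU, g, hg.contMDiffOn, fun y hy => ?_⟩
        split_ifs with hyI
        exacts [hgf y hy hyI, mem_univ _]
      · refine ⟨(Icc a b)ᶜ, isClosed_Icc.isOpen_compl.mem_nhds ht, fun _ => 0,
          contMDiffOn_const, fun y hy => ?_⟩
        rw [if_neg hy]; exact mem_univ _)
  refine ⟨g, g.contMDiff.contDiff, fun s hs => ?_⟩
  have := hg s
  rwa [if_pos hs] at this

/-- A neighbourhood of a compact interval is the target of a smooth map of the line fixing the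
interval pointwise. -/
theorem exists_contDiff_mapsTo_of_Icc_subset {T : Set ℝ} (hT : IsOpen T) {a b : ℝ} (hab : a ≤ b)
    (h : Icc a b ⊆ T) :
    ∃ ρ : ℝ → ℝ, ContDiff ℝ (⊤ : ℕ∞) ρ ∧ (∀ t, ρ t ∈ T) ∧ ∀ t ∈ Icc a b, ρ t = t := by
  classical
  obtain ⟨ε, hε, hεT⟩ := isCompact_Icc.exists_thickening_subset_open hT h
  have hsub : Ioo (a - ε) (b + ε) ⊆ T := by
    intro x hx
    apply hεT
    rw [mem_thickening_iff]
    rcases lt_or_ge x a with h1 | h1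
    · exact ⟨a, left_mem_Icc.2 hab, by rw [Real.dist_eq, abs_lt]; constructor <;> linarith [hx.1]⟩
    rcases lt_or_ge b x with h2 | h2
    · exact ⟨b, right_mem_Icc.2 hab, by rw [Real.dist_eq, abs_lt]; constructor <;> linarith [hx.2]⟩
    · exact ⟨x, ⟨h1, h2⟩, by simpa⟩
  obtain ⟨g, hg⟩ := exists_contMDiffMap_forall_mem_convex_of_local (n := (⊤ : ℕ∞))
    (modelWithCornersSelf ℝ ℝ) (F := ℝ)
    (t := fun s : ℝ => if s ∈ Icc a b then {s} else Ioo (a - ε) (b + ε))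
    (fun s => by split_ifs; exacts [convex_singleton _, convex_Ioo _ _])
    (fun t => by
      by_cases ht : t ∈ Icc a b
      · refine ⟨Ioo (a - ε) (b + ε), Ioo_mem_nhds (by linarith [ht.1]) (by linarith [ht.2]),
          id, contMDiffOn_id, fun y hy => ?_⟩
        split_ifs
        exacts [rfl, hy]
      · refine ⟨(Icc a b)ᶜ, isClosed_Icc.isOpen_compl.mem_nhds ht, fun _ => a,
          contMDiffOn_const, fun y hy => ?_⟩
        rw [if_neg hy]; constructor <;> linarith)
  refine ⟨g, g.contMDiff.contDiff, fun t => ?_, fun t ht => ?_⟩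
  · have := hg t
    split_ifs at this with ht
    · rw [mem_singleton_iff.1 this]; exact h ht
    · exact hsub this
  · have := hg t
    rwa [if_pos ht] at this

/-- A smooth function on the line has a smooth primitive. -/
theorem exists_contDiff_primitive {m : ℝ → ℝ} (hm : ContDiff ℝ (⊤ : ℕ∞) m) :
    ∃ θ : ℝ → ℝ, ContDiff ℝ (⊤ : ℕ∞) θ ∧ (∀ t, HasDerivAt θ (m t) t) ∧ θ 0 = 0 := by
  have hd : ∀ t, HasDerivAt (fun u => ∫ x in (0 : ℝ)..u, m x) (m t) t := fun t =>
    intervalIntegral.integral_hasDerivAt_right (hm.continuous.intervalIntegrable _ _)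
      hm.continuous.stronglyMeasurable.stronglyMeasurableAtFilter hm.continuous.continuousAt
  refine ⟨_, ?_, hd, by simp⟩
  rw [contDiff_infty_iff_deriv]
  exact ⟨fun t => (hd t).differentiableAt, by rwa [funext fun t => (hd t).deriv]⟩

/-- A nonvanishing vector-valued function whose derivative is parallel to it keeps a constant
direction. -/
theorem div_sqrt_sum_sq_eq_of_hasDerivWithinAt {ι : Type*} [Fintype ι] {h : ι → ℝ → ℝ}
    {κ : ℝ → ℝ} {a b : ℝ}
    (hd : ∀ t ∈ Icc a b, ∀ i, HasDerivWithinAt (h i) (κ t * h i t) (Icc a b) t)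
    (hpos : ∀ t ∈ Icc a b, 0 < ∑ i, h i t ^ 2) (i : ι) {s t : ℝ} (hs : s ∈ Icc a b)
    (ht : t ∈ Icc a b) :
    h i t / √(∑ j, h j t ^ 2) = h i s / √(∑ j, h j s ^ 2) := by
  have key : ∀ t ∈ Icc a b,
      HasDerivWithinAt (fun t => h i t / √(∑ j, h j t ^ 2)) 0 (Icc a b) t := by
    intro t ht
    have hN : HasDerivWithinAt (fun t => ∑ j, h j t ^ 2) (2 * κ t * ∑ j, h j t ^ 2)
        (Icc a b) t := by
      have := HasDerivWithinAt.fun_sum (u := Finset.univ) (fun j _ => (hd t ht j).pow 2)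
      refine this.congr_deriv ?_
      rw [Finset.mul_sum]
      exact Finset.sum_congr rfl fun j _ => by push_cast; ring
    have hp := hpos t ht
    have hq := hN.sqrt hp.ne'
    refine ((hd t ht i).div hq (Real.sqrt_pos.2 hp).ne').congr_deriv ?_
    have h2 := Real.sq_sqrt hp.le
    have h3 := (Real.sqrt_pos.2 hp).ne'
    rw [div_eq_zero_iff]
    left
    field_simp
    rw [h2]; ring
  have hc := constant_of_derivWithin_zero (fun t ht => (key t ht).differentiableWithinAt)
    (fun t ht => by
      have hlt : a < b := ht.1.trans_lt ht.2
      exact (key t (Ico_subset_Icc_self ht)).derivWithin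
        (uniqueDiffOn_Icc hlt t (Ico_subset_Icc_self ht)))
  rw [hc t ht, hc s hs]

/-- The inverse function theorem with a smooth local left inverse. -/
theorem exists_contDiffOn_leftInverse {E F : Type*} [NormedAddCommGroup E] [NormedSpace ℝ E]
    [CompleteSpace E] [NormedAddCommGroup F] [NormedSpace ℝ F] {f : E → F} {U : Set E}
    (hU : IsOpen U) (hf : ContDiffOn ℝ (⊤ : ℕ∞) f U) {p : E} (hp : p ∈ U) (e : E ≃L[ℝ] F)
    (he : HasFDerivAt f (e : E →L[ℝ] F) p) :
    ∃ N ∈ 𝓝 (f p), ∃ g : F → E, ContDiffOn ℝ (⊤ : ℕ∞) g N ∧ ∀ᶠ q in 𝓝 p, g (f q) = q := by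
  have hcd : ContDiffAt ℝ (⊤ : ℕ∞) f p := hf.contDiffAt (hU.mem_nhds hp)
  let Φ := hcd.toOpenPartialHomeomorph f he (by simp)
  have hΦ : (Φ : E → F) = f := hcd.toOpenPartialHomeomorph_coe he (by simp)
  have hps : p ∈ Φ.source := hcd.mem_toOpenPartialHomeomorph_source he (by simp)
  have hgood : ∀ᶠ q in 𝓝 p, q ∈ U ∧ fderiv ℝ f q ∈ range
      (ContinuousLinearEquiv.toContinuousLinearMap : (E ≃L[ℝ] F) → E →L[ℝ] F) := by
    refine (hU.eventually_mem hp).and ?_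
    have hc : ContinuousAt (fderiv ℝ f) p :=
      (hcd.fderiv_right (m := 0) (by simp)).continuousAt
    apply hc.eventually_mem
    rw [he.fderiv]
    exact e.nhds
  have hsymm : ContinuousAt Φ.symm (f p) := by
    rw [← hΦ]; exact Φ.continuousAt_symm (Φ.map_source hps)
  have hsp : Φ.symm (f p) = p := by rw [← hΦ]; exact Φ.left_inv hps
  have hN : ∀ᶠ y in 𝓝 (f p), y ∈ Φ.target ∧ Φ.symm y ∈ U ∧ fderiv ℝ f (Φ.symm y) ∈ range
      (ContinuousLinearEquiv.toContinuousLinearMap : (E ≃L[ℝ] F) → E →L[ℝ] F) := by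
    refine (Φ.open_target.eventually_mem ?_).and ?_
    · rw [← hΦ]; exact Φ.map_source hps
    · exact hsymm.eventually (by rwa [hsp])
  refine ⟨_, hN, Φ.symm, fun y hy => ?_, ?_⟩
  · obtain ⟨hy1, hy2, e', he'⟩ := hy
    have hcy := hf.contDiffAt (hU.mem_nhds hy2)
    refine (Φ.contDiffAt_symm (f₀' := e') hy1 ?_ ?_).contDiffWithinAt
    · rw [hΦ, he']
      exact (hcy.differentiableAt (by simp)).hasFDerivAt
    · rwa [hΦ]
  · filter_upwards [Φ.open_source.mem_nhds hps] with q hq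
    rw [← hΦ]; exact Φ.left_inv hq

section Coordinates

variable (n : ℕ)

/-- The projection `(x̄, t) ↦ x̄`. -/
noncomputable def headL : (Fin n → ℝ) →L[ℝ] (Fin (n-1) → ℝ) :=
  ContinuousLinearMap.pi fun i => ContinuousLinearMap.proj ⟨i, by omega⟩

/-- The projection `(x̄, t) ↦ t`. -/
noncomputable def lastL (hn : 2 ≤ n) : (Fin n → ℝ) →L[ℝ] ℝ :=
  ContinuousLinearMap.proj ⟨n - 1, by omega⟩

/-- The pairing `(x̄, t) ↦ toPt n x̄ t` as a continuous linear map. -/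
noncomputable def toPtL : ((Fin (n-1) → ℝ) × ℝ) →L[ℝ] (Fin n → ℝ) :=
  ContinuousLinearMap.pi fun i =>
    if h : (i : ℕ) < n - 1 then
      (ContinuousLinearMap.proj ⟨i, h⟩).comp (ContinuousLinearMap.fst ℝ _ _)
    else ContinuousLinearMap.snd ℝ _ _

theorem toPtL_apply (u : Fin (n-1) → ℝ) (t : ℝ) : toPtL n (u, t) = toPt n u t := by
  ext i
  by_cases h : (i : ℕ) < n - 1 <;> simp [toPtL, toPt, h]

theorem headL_toPt (u : Fin (n-1) → ℝ) (t : ℝ) : headL n (toPt n u t) = u := by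
  ext i
  simp [headL, toPt]

theorem lastL_toPt (hn : 2 ≤ n) (u : Fin (n-1) → ℝ) (t : ℝ) : lastL n hn (toPt n u t) = t := by
  simp [lastL, toPt]

theorem toPt_headL_lastL (hn : 2 ≤ n) (p : Fin n → ℝ) :
    toPt n (headL n p) (lastL n hn p) = p := by
  ext i
  by_cases h : (i : ℕ) < n - 1
  · simp [headL, toPt, h]
  · have : i = ⟨n - 1, by omega⟩ := Fin.ext (by have := i.2; simp; omega)
    rw [this]
    simp [lastL, toPt]

theorem toPt_sub_toPt (u w : Fin (n-1) → ℝ) (s t : ℝ) :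
    toPt n u s - toPt n w t = toPt n (u - w) (s - t) := by
  simp only [← toPtL_apply, ← map_sub, Prod.mk_sub_mk]

theorem smul_toPt (c : ℝ) (u : Fin (n-1) → ℝ) (t : ℝ) :
    c • toPt n u t = toPt n (c • u) (c * t) := by
  simp only [← toPtL_apply, ← map_smul, Prod.smul_mk, smul_eq_mul]

theorem norm_toPt_zero_le (u : Fin (n-1) → ℝ) : ‖toPt n u 0‖ ≤ ‖u‖ := by
  refine (pi_norm_le_iff_of_nonneg (norm_nonneg _)).2 fun i => ?_
  by_cases h : (i : ℕ) < n - 1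
  · simpa [toPt, h] using norm_le_pi_norm u ⟨i, h⟩
  · simp [toPt, h]

end Coordinates

/-- The left kernel of an `n × (n-1)` matrix of full rank is spanned by any nonzero element. -/
theorem exists_smul_eq_of_vecMul_eq_zero {n : ℕ} (hn : 2 ≤ n) {A : Matrix (Fin n) (Fin (n-1)) ℝ}
    (hA : A.rank = n - 1) {v w : Fin n → ℝ} (hv : v ≠ 0) (hvA : Matrix.vecMul v A = 0)
    (hwA : Matrix.vecMul w A = 0) : ∃ c : ℝ, c • v = w := by
  have hrange : Module.finrank ℝ (LinearMap.range A.transpose.mulVecLin) = n - 1 := by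
    exact (Matrix.rank_transpose A).trans hA
  have hker : Module.finrank ℝ (LinearMap.ker A.transpose.mulVecLin) = 1 := by
    have := LinearMap.finrank_range_add_finrank_ker A.transpose.mulVecLin
    rw [hrange, Module.finrank_fin_fun] at this
    omega
  have hmem : ∀ u : Fin n → ℝ, Matrix.vecMul u A = 0 → u ∈ LinearMap.ker A.transpose.mulVecLin :=
    fun u hu => by rw [LinearMap.mem_ker, Matrix.mulVecLin_apply, Matrix.mulVec_transpose, hu]
  obtain ⟨c, hc⟩ := (finrank_eq_one_iff_of_nonzero'
    (⟨v, hmem v hvA⟩ : LinearMap.ker A.transpose.mulVecLin)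
    (fun h => hv (congrArg Subtype.val h))).1 hker ⟨w, hmem w hwA⟩
  exact ⟨c, congrArg Subtype.val hc⟩

section Phase

variable {n : ℕ} {φ : (Fin n → ℝ) → (Fin (n-1) → ℝ) → ℝ} {M : Set (Fin n → ℝ)}
  {Ω : Set (Fin (n-1) → ℝ)}

/-- The Gauss map spans the left kernel of the mixed Hessian. -/
theorem gaussMap_vecMul_mixedHess (hn : 2 ≤ n) (x : Fin n → ℝ) (ξ : Fin (n-1) → ℝ) :
    Matrix.vecMul (gaussMap n φ x ξ) (mixedHess n φ x ξ) = 0 := by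
  classical
  set l : Fin n := ⟨n - 1, by omega⟩ with hl
  set A : Matrix (Fin n) (Fin n) ℝ := Matrix.of fun a b : Fin n =>
    if h : (b : ℕ) < n - 1 then mixedHess n φ x ξ a ⟨(b : ℕ), h⟩ else 0 with hA
  have hne : ∀ b : Fin n, b ≠ l → (b : ℕ) < n - 1 := fun b hb => by
    have h1 : (b : ℕ) ≠ n - 1 := fun h => hb (Fin.ext h)
    have := b.2
    omega
  have hG : ∀ i, gaussMap n φ x ξ i = A.cramer (Pi.single i 1) l := by
    intro i
    rw [Matrix.cramer_apply, gaussMap]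
    congr 1
    ext a b
    by_cases hb : b = l
    · subst hb; simp [hl]
    · simp [hA, hb, hne b hb]
  ext j
  have hj : (⟨j, by omega⟩ : Fin n) ≠ l := fun h => by
    have := congrArg Fin.val h; simp [hl] at this; omega
  calc Matrix.vecMul (gaussMap n φ x ξ) (mixedHess n φ x ξ) j
      = ∑ i, mixedHess n φ x ξ i j * A.cramer (Pi.single i 1) l := by
        simp [Matrix.vecMul, dotProduct, hG, mul_comm]
    _ = A.cramer (fun i => mixedHess n φ x ξ i j) l := by
        conv_rhs => rw [pi_eq_sum_univ' (fun i => mixedHess n φ x ξ i j)]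
        rw [map_sum, Finset.sum_apply]
        refine Finset.sum_congr rfl fun i _ => ?_
        rw [map_smul, Pi.smul_apply, smul_eq_mul]
    _ = 0 := by
        rw [Matrix.cramer_apply]
        refine Matrix.det_zero_of_column_eq hj fun a => ?_
        rw [Matrix.updateCol_self, Matrix.updateCol_ne hj]
        simp [hA]

theorem gaussMap_ne_zero (hn : 2 ≤ n) {x : Fin n → ℝ} {ξ : Fin (n-1) → ℝ}
    (h : (GDhess n φ x ξ).det ≠ 0) : gaussMap n φ x ξ ≠ 0 := by
  intro h0
  have : Nonempty (Fin (n-1)) := ⟨⟨0, by omega⟩⟩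
  have hz : GDhess n φ x ξ = 0 := by
    ext i j
    simp [GDhess, GD, h0]
  exact h (by rw [hz, Matrix.det_zero])

theorem contDiffOn_gradXi (hM : IsOpen M) (hΩ : IsOpen Ω)
    (hφ : ContDiffOn ℝ (⊤ : ℕ∞) (fun q : (Fin n → ℝ) × (Fin (n-1) → ℝ) => φ q.1 q.2) (M ×ˢ Ω)) :
    ContDiffOn ℝ (⊤ : ℕ∞) (fun q : (Fin n → ℝ) × (Fin (n-1) → ℝ) => gradXi n φ q.1 q.2)
      (M ×ˢ Ω) := by
  rw [contDiffOn_pi]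
  intro j q hq
  have hcd : ContDiffAt ℝ (⊤ : ℕ∞) (fun q : (Fin n → ℝ) × (Fin (n-1) → ℝ) => φ q.1 q.2) q :=
    hφ.contDiffAt ((hM.prod hΩ).mem_nhds hq)
  have h : ContDiffAt ℝ (⊤ : ℕ∞)
      (fun q : (Fin n → ℝ) × (Fin (n-1) → ℝ) => fderiv ℝ (φ q.1) q.2) q := by
    refine ContDiffAt.fderiv (n := (⊤ : ℕ∞))
      (f := fun (q : (Fin n → ℝ) × (Fin (n-1) → ℝ)) η => φ q.1 η)
      (g := Prod.snd) ?_ contDiffAt_snd (by simp)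
    exact ContDiffAt.comp (q, q.2)
      (f := fun r : ((Fin n → ℝ) × (Fin (n-1) → ℝ)) × (Fin (n-1) → ℝ) => (r.1.1, r.2))
      hcd (by fun_prop)
  exact (h.clm_apply contDiffAt_const).contDiffWithinAt

theorem contDiffAt_gradXi_left (hM : IsOpen M) (hΩ : IsOpen Ω)
    (hφ : ContDiffOn ℝ (⊤ : ℕ∞) (fun q : (Fin n → ℝ) × (Fin (n-1) → ℝ) => φ q.1 q.2) (M ×ˢ Ω))
    {x : Fin n → ℝ} {ξ : Fin (n-1) → ℝ} (hx : x ∈ M) (hξ : ξ ∈ Ω) :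
    ContDiffAt ℝ (⊤ : ℕ∞) (fun y => gradXi n φ y ξ) x :=
  ContDiffAt.comp x (g := fun q : (Fin n → ℝ) × (Fin (n-1) → ℝ) => gradXi n φ q.1 q.2)
    (f := fun y => (y, ξ))
    ((contDiffOn_gradXi hM hΩ hφ).contDiffAt ((hM.prod hΩ).mem_nhds ⟨hx, hξ⟩)) (by fun_prop)

theorem contDiffAt_hessXi (hM : IsOpen M) (hΩ : IsOpen Ω)
    (hφ : ContDiffOn ℝ (⊤ : ℕ∞) (fun q : (Fin n → ℝ) × (Fin (n-1) → ℝ) => φ q.1 q.2) (M ×ˢ Ω))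
    {x : Fin n → ℝ} {ξ : Fin (n-1) → ℝ} (hx : x ∈ M) (hξ : ξ ∈ Ω) (i j : Fin (n-1)) :
    ContDiffAt ℝ (⊤ : ℕ∞) (fun y => hessXi n φ y ξ i j) x := by
  have h : ContDiffAt ℝ (⊤ : ℕ∞)
      (fun y : Fin n → ℝ => fderiv ℝ (fun η => gradXi n φ y η i) ξ) x := by
    refine ContDiffAt.fderiv (n := (⊤ : ℕ∞)) (f := fun y η => gradXi n φ y η i)
      (g := fun _ => ξ) ?_ contDiffAt_const (by simp)
    exact contDiffAt_pi.1 ((contDiffOn_gradXi hM hΩ hφ).contDiffAt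
      ((hM.prod hΩ).mem_nhds ⟨hx, hξ⟩)) i
  exact h.clm_apply contDiffAt_const

theorem contDiffAt_gaussMap (hM : IsOpen M) (hΩ : IsOpen Ω)
    (hφ : ContDiffOn ℝ (⊤ : ℕ∞) (fun q : (Fin n → ℝ) × (Fin (n-1) → ℝ) => φ q.1 q.2) (M ×ˢ Ω))
    {x : Fin n → ℝ} {ξ : Fin (n-1) → ℝ} (hx : x ∈ M) (hξ : ξ ∈ Ω) :
    ContDiffAt ℝ (⊤ : ℕ∞) (fun y => gaussMap n φ y ξ) x := by
  have hmix : ∀ i j, ContDiffAt ℝ (⊤ : ℕ∞) (fun y => mixedHess n φ y ξ i j) x := fun i j =>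
    ((contDiffAt_pi.1 (contDiffAt_gradXi_left hM hΩ hφ hx hξ) j).fderiv_right
      (m := (⊤ : ℕ∞)) (by simp)).clm_apply contDiffAt_const
  rw [contDiffAt_pi]
  intro i
  simp only [gaussMap, Matrix.det_apply]
  refine ContDiffAt.sum fun σ _ => ContDiffAt.const_smul _ (contDiffAt_prod fun b _ => ?_)
  simp only [Matrix.of_apply]
  split_ifs
  exacts [hmix _ _, contDiffAt_const]

theorem contDiffAt_GD (hM : IsOpen M) (hΩ : IsOpen Ω)
    (hφ : ContDiffOn ℝ (⊤ : ℕ∞) (fun q : (Fin n → ℝ) × (Fin (n-1) → ℝ) => φ q.1 q.2) (M ×ˢ Ω))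
    {x : Fin n → ℝ} {ξ : Fin (n-1) → ℝ} (hx : x ∈ M) (hξ : ξ ∈ Ω) {f : (Fin n → ℝ) → ℝ}
    (hf : ContDiffAt ℝ (⊤ : ℕ∞) f x) : ContDiffAt ℝ (⊤ : ℕ∞) (GD n φ f ξ) x :=
  (hf.fderiv_right (m := (⊤ : ℕ∞)) (by simp)).clm_apply (contDiffAt_gaussMap hM hΩ hφ hx hξ)

theorem apply_eq_sum_mul_single {k : ℕ} (L : (Fin k → ℝ) →L[ℝ] ℝ) (w : Fin k → ℝ) :
    L w = ∑ i, w i * L (Pi.single i 1) := by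
  conv_lhs => rw [← Finset.univ_sum_single w, map_sum]
  refine Finset.sum_congr rfl fun i _ => ?_
  rw [← smul_eq_mul, ← map_smul, ← Pi.single_smul, smul_eq_mul, mul_one]

theorem fderiv_gradXi_left {x : Fin n → ℝ} {ξ : Fin (n-1) → ℝ}
    (h : DifferentiableAt ℝ (fun y => gradXi n φ y ξ) x) (w : Fin n → ℝ) :
    fderiv ℝ (fun y => gradXi n φ y ξ) x w = Matrix.vecMul w (mixedHess n φ x ξ) := by
  ext j
  have h1 : fderiv ℝ (fun y => gradXi n φ y ξ) x w j
      = fderiv ℝ (fun y => gradXi n φ y ξ j) x w := by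
    rw [fderiv_apply h]; rfl
  rw [h1, apply_eq_sum_mul_single]
  simp only [Matrix.vecMul, dotProduct, mixedHess, Matrix.of_apply]

theorem fderiv_gradXi_right {x : Fin n → ℝ} {ξ : Fin (n-1) → ℝ}
    (h : DifferentiableAt ℝ (fun η => gradXi n φ x η) ξ) (η : Fin (n-1) → ℝ) :
    fderiv ℝ (fun η => gradXi n φ x η) ξ η = Matrix.mulVec (hessXi n φ x ξ) η := by
  ext i
  have h1 : fderiv ℝ (fun η => gradXi n φ x η) ξ η i
      = fderiv ℝ (fun η => gradXi n φ x η i) ξ η := by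
    rw [fderiv_apply h]; rfl
  rw [h1, apply_eq_sum_mul_single]
  simp only [Matrix.mulVec, dotProduct, hessXi, Matrix.of_apply]
  exact Finset.sum_congr rfl fun j _ => mul_comm _ _

/-- The total derivative of `∇_ξφ` in terms of the mixed Hessian and the `ξ`-Hessian. -/
theorem fderiv_gradXi_prod (hM : IsOpen M) (hΩ : IsOpen Ω)
    (hφ : ContDiffOn ℝ (⊤ : ℕ∞) (fun q : (Fin n → ℝ) × (Fin (n-1) → ℝ) => φ q.1 q.2) (M ×ˢ Ω))
    {x : Fin n → ℝ} {ξ : Fin (n-1) → ℝ} (hx : x ∈ M) (hξ : ξ ∈ Ω)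
    (w : Fin n → ℝ) (η : Fin (n-1) → ℝ) :
    fderiv ℝ (fun q : (Fin n → ℝ) × (Fin (n-1) → ℝ) => gradXi n φ q.1 q.2) (x, ξ) (w, η)
      = fderiv ℝ (fun y => gradXi n φ y ξ) x w + Matrix.mulVec (hessXi n φ x ξ) η := by
  have hd : HasFDerivAt (fun q : (Fin n → ℝ) × (Fin (n-1) → ℝ) => gradXi n φ q.1 q.2) _ (x, ξ) :=
    (((contDiffOn_gradXi hM hΩ hφ).contDiffAt ((hM.prod hΩ).mem_nhds ⟨hx, hξ⟩)).differentiableAt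
      (by simp)).hasFDerivAt
  have h1 := HasFDerivAt.comp x (f := fun y => (y, ξ)) hd
    ((hasFDerivAt_id (𝕜 := ℝ) x).prodMk (hasFDerivAt_const ξ x))
  have h2 := HasFDerivAt.comp ξ (f := fun η => (x, η)) hd
    ((hasFDerivAt_const x ξ).prodMk (hasFDerivAt_id (𝕜 := ℝ) ξ))
  have e1 : fderiv ℝ (fun y => gradXi n φ y ξ) x = _ := h1.fderiv
  have e2 : fderiv ℝ (fun η => gradXi n φ x η) ξ = _ := h2.fderiv
  rw [← fderiv_gradXi_right h2.differentiableAt, e1, e2]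
  simp only [ContinuousLinearMap.comp_apply, ← map_add]
  simp

theorem contDiffAt_GDhess (hM : IsOpen M) (hΩ : IsOpen Ω)
    (hφ : ContDiffOn ℝ (⊤ : ℕ∞) (fun q : (Fin n → ℝ) × (Fin (n-1) → ℝ) => φ q.1 q.2) (M ×ˢ Ω))
    {x : Fin n → ℝ} {ξ : Fin (n-1) → ℝ} (hx : x ∈ M) (hξ : ξ ∈ Ω) (i j : Fin (n-1)) :
    ContDiffAt ℝ (⊤ : ℕ∞) (fun y => GDhess n φ y ξ i j) x :=
  contDiffAt_GD hM hΩ hφ hx hξ (contDiffAt_hessXi hM hΩ hφ hx hξ i j)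

/-- Where the Gauss map is not horizontal, `∇_{x̄}∇_ξφ` is invertible. -/
theorem eq_zero_of_fderiv_gradXi_toPt_eq_zero (hn : 2 ≤ n) (hM : IsOpen M) (hΩ : IsOpen Ω)
    (hφ : IsHormander n φ M Ω) {x : Fin n → ℝ} {ξ : Fin (n-1) → ℝ} (hx : x ∈ M) (hξ : ξ ∈ Ω)
    (hG : lastL n hn (gaussMap n φ x ξ) ≠ 0) {u : Fin (n-1) → ℝ}
    (hu : fderiv ℝ (fun y => gradXi n φ y ξ) x (toPt n u 0) = 0) : u = 0 := by
  have hd := (contDiffAt_gradXi_left hM hΩ hφ.1 hx hξ).differentiableAt (by simp)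
  rw [fderiv_gradXi_left hd] at hu
  obtain ⟨c, hc⟩ := exists_smul_eq_of_vecMul_eq_zero hn (hφ.2.1 x hx ξ hξ)
    (gaussMap_ne_zero hn (hφ.2.2 x hx ξ hξ)) (gaussMap_vecMul_mixedHess hn x ξ) hu
  have h1 := congrArg (lastL n hn) hc
  rw [map_smul, lastL_toPt, smul_eq_zero, or_iff_left hG] at h1
  have h2 := congrArg (headL n) hc
  rw [h1, zero_smul, map_zero, headL_toPt] at h2
  exact h2.symm

/-- A curve on which `∇_ξφ(·, ξ)` is constant and whose last coordinate has unit speed is tangent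
to the Gauss map. -/
theorem eq_smul_gaussMap_of_gradXi_eq (hn : 2 ≤ n) (hM : IsOpen M) (hΩ : IsOpen Ω)
    (hφ : IsHormander n φ M Ω) {ξ v : Fin (n-1) → ℝ} (hξ : ξ ∈ Ω) {γ : ℝ → Fin n → ℝ} {a b : ℝ}
    (hab : a < b) (hγ : ∀ s ∈ Icc a b, γ s ∈ M ∧ gradXi n φ (γ s) ξ = v) {t : ℝ}
    (ht : t ∈ Icc a b) {γ' : Fin n → ℝ} (hd : HasDerivWithinAt γ γ' (Icc a b) t)
    (h1 : lastL n hn γ' = 1) :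
    lastL n hn (gaussMap n φ (γ t) ξ) ≠ 0 ∧
      γ' = (lastL n hn (gaussMap n φ (γ t) ξ))⁻¹ • gaussMap n φ (γ t) ξ := by
  have hx := (hγ t ht).1
  have hf := (contDiffAt_gradXi_left hM hΩ hφ.1 hx hξ).differentiableAt (by simp)
  have hcomp := hf.hasFDerivAt.comp_hasDerivWithinAt t hd
  have hconst : HasDerivWithinAt ((fun y => gradXi n φ y ξ) ∘ γ) 0 (Icc a b) t :=
    (hasDerivWithinAt_const t (Icc a b) v).congr (fun s hs => (hγ s hs).2) (hγ t ht).2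
  have hzero := (uniqueDiffOn_Icc hab t ht).eq_deriv _ hcomp hconst
  rw [fderiv_gradXi_left hf] at hzero
  obtain ⟨c, hc⟩ := exists_smul_eq_of_vecMul_eq_zero hn (hφ.2.1 _ hx ξ hξ)
    (gaussMap_ne_zero hn (hφ.2.2 _ hx ξ hξ)) (gaussMap_vecMul_mixedHess hn (γ t) ξ) hzero
  have h2 := congrArg (lastL n hn) hc
  rw [map_smul, h1, smul_eq_mul] at h2
  have hG : lastL n hn (gaussMap n φ (γ t) ξ) ≠ 0 := right_ne_zero_of_mul_eq_one h2
  exact ⟨hG, by rw [← hc, eq_inv_of_mul_eq_one_left h2]⟩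

/-- A fibre curve of `∇_ξφ(·, ξ)` that is a graph over a compact interval extends smoothly to the
whole line. -/
theorem exists_contDiff_fibre_extension (hn : 2 ≤ n) (hM : IsOpen M) (hΩ : IsOpen Ω)
    (hφ : IsHormander n φ M Ω) {ξ v : Fin (n-1) → ℝ} (hξ : ξ ∈ Ω) {x : ℝ → Fin (n-1) → ℝ}
    {a b : ℝ} (hx : ContinuousOn x (Icc a b))
    (hγ : ∀ s ∈ Icc a b, toPt n (x s) s ∈ M ∧ gradXi n φ (toPt n (x s) s) ξ = v)
    (hG : ∀ s ∈ Icc a b, lastL n hn (gaussMap n φ (toPt n (x s) s) ξ) ≠ 0) :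
    ∃ y : ℝ → Fin (n-1) → ℝ, ContDiff ℝ (⊤ : ℕ∞) y ∧ EqOn y x (Icc a b) := by
  refine exists_contDiff_eqOn_Icc fun t ht => ?_
  have hf : ContDiffOn ℝ (⊤ : ℕ∞) (fun p => (gradXi n φ p ξ, lastL n hn p)) M := fun p hp =>
    ((contDiffAt_gradXi_left hM hΩ hφ.1 hp hξ).prodMk
      (lastL n hn).contDiff.contDiffAt).contDiffWithinAt
  have hp := (hγ t ht).1
  have hd := (contDiffAt_gradXi_left hM hΩ hφ.1 hp hξ).differentiableAt (by simp)
  set L := (fderiv ℝ (fun y => gradXi n φ y ξ) (toPt n (x t) t)).prod (lastL n hn) with hL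
  have hinj : Function.Injective (L : (Fin n → ℝ) →ₗ[ℝ] (Fin (n-1) → ℝ) × ℝ) := by
    refine (injective_iff_map_eq_zero _).2 fun w hw => ?_
    have hw1 : fderiv ℝ (fun y => gradXi n φ y ξ) (toPt n (x t) t) w = 0 :=
      congrArg Prod.fst hw
    have hw2 : lastL n hn w = 0 := congrArg Prod.snd hw
    rw [← toPt_headL_lastL n hn w, hw2] at hw1 ⊢
    rw [eq_zero_of_fderiv_gradXi_toPt_eq_zero hn hM hΩ hφ hp hξ (hG t ht) hw1, ← toPtL_apply]
    exact map_zero _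
  let e : (Fin n → ℝ) ≃L[ℝ] (Fin (n-1) → ℝ) × ℝ :=
    (LinearMap.linearEquivOfInjective (L : (Fin n → ℝ) →ₗ[ℝ] (Fin (n-1) → ℝ) × ℝ) hinj
      (by rw [Module.finrank_prod, Module.finrank_fin_fun, Module.finrank_fin_fun,
        Module.finrank_self]; omega)).toContinuousLinearEquiv
  have he : HasFDerivAt (fun p => (gradXi n φ p ξ, lastL n hn p))
      (e : (Fin n → ℝ) →L[ℝ] (Fin (n-1) → ℝ) × ℝ) (toPt n (x t) t) := by
    have : (e : (Fin n → ℝ) →L[ℝ] (Fin (n-1) → ℝ) × ℝ) = L := by ext1 w; rfl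
    rw [this]
    exact hd.hasFDerivAt.prodMk (lastL n hn).hasFDerivAt
  obtain ⟨N, hN, g, hg, hgf⟩ := exists_contDiffOn_leftInverse hM hf hp e he
  simp only [(hγ t ht).2, lastL_toPt] at hN
  have hcγ : ContinuousWithinAt (fun s => toPt n (x s) s) (Icc a b) t := by
    simp only [← toPtL_apply]
    exact (toPtL n).continuous.continuousAt.comp_continuousWithinAt
      ((hx t ht).prodMk continuousWithinAt_id)
  have hev := eventually_nhdsWithin_iff.1 (hcγ.eventually hgf)
  have hpre : (fun s : ℝ => (v, s)) ⁻¹' N ∈ 𝓝 t :=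
    (Continuous.prodMk_right v).continuousAt.preimage_mem_nhds hN
  refine ⟨_, Filter.inter_mem hpre hev, fun s => headL n (g (v, s)), ?_, ?_⟩
  · exact (headL n).contDiff.comp_contDiffOn
      (hg.comp (contDiff_prodMk_right v).contDiffOn fun s hs => hs.1)
  · intro s hs hsI
    have := hs.2 hsI
    simp only [(hγ s hsI).2, lastL_toPt] at this
    simp only [this, headL_toPt]

/-- Bourgain's condition makes the `ξ`-Hessian move along a fixed matrix on each fibre curve; this
provides the data of a global straightening map. -/
theorem exists_straightening_data (hn : 2 ≤ n) (hM : IsOpen M) (hΩ : IsOpen Ω)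
    (hφ : IsHormander n φ M Ω) (hB : BourgainCond n φ M Ω) {ξ v : Fin (n-1) → ℝ} (hξ : ξ ∈ Ω)
    {x : ℝ → Fin (n-1) → ℝ} (hx : ContDiffOn ℝ (⊤ : ℕ∞) x (Icc (-1) 1))
    (hγ : ∀ s ∈ Icc (-1 : ℝ) 1, toPt n (x s) s ∈ M ∧ gradXi n φ (toPt n (x s) s) ξ = v) :
    ∃ (D : ℝ → (Fin (n-1) → ℝ) →L[ℝ] (Fin (n-1) → ℝ)) (z : ℝ → Fin (n-1) → ℝ) (θ m : ℝ → ℝ)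
      (A B : Matrix (Fin (n-1)) (Fin (n-1)) ℝ),
      ContDiff ℝ (⊤ : ℕ∞) D ∧ ContDiff ℝ (⊤ : ℕ∞) z ∧ ContDiff ℝ (⊤ : ℕ∞) θ ∧
      (∀ t u, D t u = 0 → u = 0) ∧ (∀ t, HasDerivAt θ (m t) t ∧ m t ≠ 0) ∧ B.det ≠ 0 ∧
      ∀ t ∈ Icc (-1 : ℝ) 1, z t = x t ∧
        (∀ u, D t u = fderiv ℝ (fun y => gradXi n φ y ξ) (toPt n (x t) t) (toPt n u 0)) ∧
        hessXi n φ (toPt n (x t) t) ξ = A + θ t • B := by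
  have hG : ∀ s ∈ Icc (-1 : ℝ) 1, lastL n hn (gaussMap n φ (toPt n (x s) s) ξ) ≠ 0 := by
    intro s hs
    have h1 := ((hx s hs).differentiableWithinAt (by simp)).hasDerivWithinAt
    have h2 := (toPtL n).hasFDerivAt.comp_hasDerivWithinAt s
      (h1.prodMk (hasDerivWithinAt_id s _))
    refine (eq_smul_gaussMap_of_gradXi_eq hn hM hΩ hφ hξ (γ := fun s => toPt n (x s) s)
      (by norm_num) hγ hs (h2.congr_of_mem (fun r _ => (toPtL_apply n _ _).symm) hs) ?_).1
    rw [toPtL_apply, lastL_toPt]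
  obtain ⟨y, hy, hyx⟩ := exists_contDiff_fibre_extension hn hM hΩ hφ hξ hx.continuousOn hγ hG
  set γ : ℝ → Fin n → ℝ := fun s => toPt n (y s) s with hγdef
  have hγx : ∀ s ∈ Icc (-1 : ℝ) 1, γ s = toPt n (x s) s := fun s hs => by
    simp only [hγdef, hyx hs]
  have hγsm : ContDiff ℝ (⊤ : ℕ∞) γ := by
    simp only [hγdef, ← toPtL_apply]
    exact (toPtL n).contDiff.comp (hy.prodMk contDiff_id)
  have hγd : ∀ s ∈ Icc (-1 : ℝ) 1, HasDerivWithinAt γ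
      ((lastL n hn (gaussMap n φ (γ s) ξ))⁻¹ • gaussMap n φ (γ s) ξ) (Icc (-1) 1) s := by
    intro s hs
    have h1 := ((hy.differentiable (by simp)) s).hasDerivAt
    have h2 := (toPtL n).hasFDerivAt.comp_hasDerivAt s (h1.prodMk (hasDerivAt_id s))
    have h3 : HasDerivAt γ (toPtL n (deriv y s, 1)) s :=
      h2.congr_of_eventuallyEq (Filter.Eventually.of_forall fun r => (toPtL_apply n _ _).symm)
    have h4 := eq_smul_gaussMap_of_gradXi_eq hn hM hΩ hφ hξ (γ := γ) (a := -1) (b := 1)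
      (by norm_num) (fun r hr => by rw [hγx r hr]; exact hγ r hr) hs h3.hasDerivWithinAt
      (by rw [toPtL_apply, lastL_toPt])
    rw [← h4.2]
    exact h3.hasDerivWithinAt
  set S : (Fin n → ℝ) → ℝ := fun p => ∑ k : Fin (n-1) × Fin (n-1), GDhess n φ p ξ k.1 k.2 ^ 2
  have hS : ∀ p ∈ M, 0 < S p := by
    intro p hp
    refine lt_of_le_of_ne (Finset.sum_nonneg fun _ _ => sq_nonneg _) fun h0 => ?_
    have hz : GDhess n φ p ξ = 0 := by
      ext i j
      have := (Finset.sum_eq_zero_iff_of_nonneg fun _ _ => sq_nonneg _).1 h0.symm (i, j)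
        (Finset.mem_univ _)
      simpa using this
    have : Nonempty (Fin (n-1)) := ⟨⟨0, by omega⟩⟩
    exact hφ.2.2 p hp ξ hξ (by rw [hz, Matrix.det_zero])
  set μ : (Fin n → ℝ) → ℝ := fun p => (lastL n hn (gaussMap n φ p ξ))⁻¹ * √(S p)
  set M' : Set (Fin n → ℝ) := M ∩ (fun p => lastL n hn (gaussMap n φ p ξ)) ⁻¹' {0}ᶜ with hM'
  have hM'o : IsOpen M' := by
    refine ContinuousOn.isOpen_inter_preimage (fun p hp => ?_) hM isOpen_compl_singleton
    exact ((lastL n hn).continuous.continuousAt.comp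
      (contDiffAt_gaussMap hM hΩ hφ.1 hp hξ).continuousAt).continuousWithinAt
  have hμsm : ∀ p ∈ M', ContDiffAt ℝ (⊤ : ℕ∞) μ p := by
    intro p hp
    refine ContDiffAt.mul (ContDiffAt.inv ((lastL n hn).contDiff.contDiffAt.comp p
      (contDiffAt_gaussMap hM hΩ hφ.1 hp.1 hξ)) hp.2) (ContDiffAt.sqrt ?_ (hS p hp.1).ne')
    exact ContDiffAt.sum fun k _ => (contDiffAt_GDhess hM hΩ hφ.1 hp.1 hξ k.1 k.2).pow 2
  have hγM : ∀ s ∈ Icc (-1 : ℝ) 1, γ s ∈ M := fun s hs => by rw [hγx s hs]; exact (hγ s hs).1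
  obtain ⟨ρ, hρ, hρT, hρI⟩ := exists_contDiff_mapsTo_of_Icc_subset
    (hM'o.preimage hγsm.continuous) (a := -1) (b := 1) (by norm_num)
    (fun s hs => ⟨hγM s hs, by rw [hγx s hs]; exact hG s hs⟩)
  have hγρ : ContDiff ℝ (⊤ : ℕ∞) (fun t => γ (ρ t)) := hγsm.comp hρ
  obtain ⟨θ, hθ, hθd, -⟩ := exists_contDiff_primitive (m := fun t => μ (γ (ρ t)))
    (contDiff_iff_contDiffAt.2 fun t => ContDiffAt.comp t (g := μ) (hμsm _ (hρT t))
      hγρ.contDiffAt)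
  have h0 : (0 : ℝ) ∈ Icc (-1 : ℝ) 1 := by constructor <;> norm_num
  set B := (√(S (γ 0)))⁻¹ • GDhess n φ (γ 0) ξ with hBdef
  obtain ⟨lam, hlam⟩ := hB
  have hHd : ∀ t ∈ Icc (-1 : ℝ) 1, ∀ k : Fin (n-1) × Fin (n-1),
      HasDerivWithinAt (fun t => GDhess n φ (γ t) ξ k.1 k.2)
        ((lastL n hn (gaussMap n φ (γ t) ξ))⁻¹ * lam (γ t) ξ * GDhess n φ (γ t) ξ k.1 k.2)
        (Icc (-1) 1) t := by
    intro t ht k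
    have hd := (contDiffAt_GDhess hM hΩ hφ.1 (hγM t ht) hξ k.1 k.2).differentiableAt (by simp)
    refine (hd.hasFDerivAt.comp_hasDerivWithinAt t (hγd t ht)).congr_deriv ?_
    have h2 : fderiv ℝ (fun y => GDhess n φ y ξ k.1 k.2) (γ t) (gaussMap n φ (γ t) ξ)
        = lam (γ t) ξ * GDhess n φ (γ t) ξ k.1 k.2 :=
      congrFun (congrFun (hlam (γ t) (hγM t ht) ξ hξ) k.1) k.2
    rw [map_smul, h2, smul_eq_mul, mul_assoc]
  have hdir : ∀ t ∈ Icc (-1 : ℝ) 1, ∀ i j, GDhess n φ (γ t) ξ i j = √(S (γ t)) * B i j := by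
    intro t ht i j
    have := div_sqrt_sum_sq_eq_of_hasDerivWithinAt hHd (fun s hs => hS _ (hγM s hs)) (i, j) h0 ht
    rw [div_eq_iff (Real.sqrt_pos.2 (hS _ (hγM t ht))).ne'] at this
    rw [this, hBdef, Matrix.smul_apply, smul_eq_mul]
    simp only [S]
    ring
  have hAB : ∀ t ∈ Icc (-1 : ℝ) 1, ∀ i j, hessXi n φ (γ t) ξ i j - θ t * B i j
      = hessXi n φ (γ (-1)) ξ i j - θ (-1) * B i j := by
    intro t ht i j
    have hd : ∀ s ∈ Icc (-1 : ℝ) 1, HasDerivWithinAt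
        (fun s => hessXi n φ (γ s) ξ i j - θ s * B i j) 0 (Icc (-1) 1) s := by
      intro s hs
      have hd := (contDiffAt_hessXi hM hΩ hφ.1 (hγM s hs) hξ i j).differentiableAt (by simp)
      refine ((hd.hasFDerivAt.comp_hasDerivWithinAt s (hγd s hs)).sub
        ((hθd s).hasDerivWithinAt.mul_const (B i j))).congr_deriv ?_
      have h2 : fderiv ℝ (fun y => hessXi n φ y ξ i j) (γ s) (gaussMap n φ (γ s) ξ)
        = GDhess n φ (γ s) ξ i j := rfl
      rw [map_smul, h2, hdir s hs, hρI s hs, smul_eq_mul]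
      simp only [μ]
      ring
    exact constant_of_derivWithin_zero (fun s hs => (hd s hs).differentiableWithinAt)
      (fun s hs => (hd s (Ico_subset_Icc_self hs)).derivWithin
        (uniqueDiffOn_Icc (by norm_num) s (Ico_subset_Icc_self hs))) t ht
  refine ⟨fun t => (fderiv ℝ (fun y => gradXi n φ y ξ) (γ (ρ t))).comp
      ((toPtL n).comp (ContinuousLinearMap.inl ℝ _ _)), y, θ, fun t => μ (γ (ρ t)),
    hessXi n φ (γ (-1)) ξ - θ (-1) • B, B, ?_, hy, hθ, ?_, ?_, ?_, ?_⟩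
  · refine ContDiff.clm_comp (contDiff_iff_contDiffAt.2 fun t => ?_) contDiff_const
    exact ContDiffAt.comp t (((contDiffAt_gradXi_left hM hΩ hφ.1 (hρT t).1 hξ).fderiv_right
      (m := (⊤ : ℕ∞)) (by simp))) hγρ.contDiffAt
  · intro t u hu
    refine eq_zero_of_fderiv_gradXi_toPt_eq_zero hn hM hΩ hφ (hρT t).1 hξ (hρT t).2 ?_
    simpa [toPtL_apply] using hu
  · exact fun t => ⟨hθd t, mul_ne_zero (inv_ne_zero (hρT t).2)
      (Real.sqrt_pos.2 (hS _ (hρT t).1)).ne'⟩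
  · rw [hBdef, Matrix.det_smul]
    exact mul_ne_zero (pow_ne_zero _ (inv_ne_zero (Real.sqrt_pos.2 (hS _ (hγM 0 h0))).ne'))
      (hφ.2.2 _ (hγM 0 h0) ξ hξ)
  · intro t ht
    refine ⟨hyx ht, fun u => ?_, ?_⟩
    · simp [toPtL_apply, hρI t ht, hγx t ht]
    · rw [← hγx t ht]
      ext i j
      have := hAB t ht i j
      simp only [Matrix.add_apply, Matrix.sub_apply, Matrix.smul_apply, smul_eq_mul]
      linarith

end Phase

/-- A fibrewise affine map over a reparametrized last coordinate is a local diffeomorphism. -/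
theorem isUnit_fderiv_fibrewise_affine {n : ℕ} (hn : 2 ≤ n)
    {D : ℝ → (Fin (n-1) → ℝ) →L[ℝ] (Fin (n-1) → ℝ)} {z : ℝ → Fin (n-1) → ℝ} {θ m : ℝ → ℝ}
    (hD : ContDiff ℝ (⊤ : ℕ∞) D) (hz : ContDiff ℝ (⊤ : ℕ∞) z)
    (hDinj : ∀ t u, D t u = 0 → u = 0) (hθd : ∀ t, HasDerivAt θ (m t) t ∧ m t ≠ 0)
    (v : Fin (n-1) → ℝ) (p : Fin n → ℝ) :
    IsUnit (fderiv ℝ (fun p => toPt n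
      (v + D (lastL n hn p) (headL n p - z (lastL n hn p))) (θ (lastL n hn p))) p) := by
  have hlast := (lastL n hn).hasFDerivAt (x := p)
  have hDd := ((hD.differentiable (by simp)) (lastL n hn p)).hasFDerivAt.comp p hlast
  have hzd := ((hz.differentiable (by simp)) (lastL n hn p)).hasFDerivAt.comp p hlast
  have hhd := (headL n).hasFDerivAt (x := p)
  have h1 := (hDd.clm_apply (hhd.sub hzd)).const_add v
  have h2 := (hθd (lastL n hn p)).1.hasFDerivAt.comp p hlast
  have h3 := (toPtL n).hasFDerivAt.comp p (h1.prodMk h2)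
  have h4 := h3.congr_of_eventuallyEq (f₁ := fun p => toPt n
      (v + D (lastL n hn p) (headL n p - z (lastL n hn p))) (θ (lastL n hn p)))
    (Filter.Eventually.of_forall fun r => (toPtL_apply n _ _).symm)
  rw [h4.fderiv, ContinuousLinearMap.isUnit_iff_bijective]
  refine (fun hinj => ⟨hinj, LinearMap.injective_iff_surjective.1 hinj⟩)
    ((injective_iff_map_eq_zero _).2 fun w hw => ?_)
  rw [ContinuousLinearMap.comp_apply, ContinuousLinearMap.prod_apply, toPtL_apply] at hw
  have e1 := congrArg (lastL n hn) hw
  rw [lastL_toPt, map_zero] at e1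
  have hw0 : lastL n hn w = 0 := by
    simpa [(hθd (lastL n hn p)).2] using e1
  have e2 := congrArg (headL n) hw
  rw [headL_toPt, map_zero] at e2
  have e3 : D (lastL n hn p) (headL n w) = 0 := by
    simpa [hw0] using e2
  rw [← toPt_headL_lastL n hn w, hw0, hDinj _ _ e3, ← toPtL_apply]
  exact map_zero _


theorem stmt5 (n : ℕ) (hn : 2 ≤ n)
    (M : Set (Fin n → ℝ)) (Ω : Set (Fin (n-1) → ℝ))
    (hMo : IsOpen M) (hMc : IsConnected M) (hΩo : IsOpen Ω) (hΩc : IsConnected Ω)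
    (φ : (Fin n → ℝ) → (Fin (n-1) → ℝ) → ℝ)
    (hφ : IsHormander n φ M Ω)
    (hB : BourgainCond n φ M Ω)
    (V : Set (Fin (n-1) → ℝ))
    (hV : V = (fun q : (Fin n → ℝ) × (Fin (n-1) → ℝ) => gradXi n φ q.1 q.2) '' (M ×ˢ Ω))
    (X : (Fin (n-1) → ℝ) → (Fin (n-1) → ℝ) → ℝ → (Fin (n-1) → ℝ))
    (hXsm : ContDiffOn ℝ (⊤ : ℕ∞)
      (fun q : ((Fin (n-1) → ℝ) × (Fin (n-1) → ℝ)) × ℝ => X q.1.1 q.1.2 q.2)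
      ((Ω ×ˢ V) ×ˢ Icc (-1:ℝ) 1))
    (hXdef : ∀ ξ ∈ Ω, ∀ v ∈ V, ∀ t ∈ Icc (-1:ℝ) 1,
      toPt n (X ξ v t) t ∈ M ∧ gradXi n φ (toPt n (X ξ v t) t) ξ = v)
    (ξ₀ : Fin (n-1) → ℝ) (hξ₀ : ξ₀ ∈ Ω) (v₀ : Fin (n-1) → ℝ) (hv₀ : v₀ ∈ V) :
    ∃ (F : (Fin n → ℝ) → (Fin n → ℝ)) (Ξ : (Fin (n-1) → ℝ) → (Fin (n-1) → ℝ))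
      (W : (Fin (n-1) → ℝ) → (Fin (n-1) → ℝ) → (Fin (n-1) → ℝ))
      (C : ℝ) (K : Set ((Fin (n-1) → ℝ) × (Fin (n-1) → ℝ))),
      ContDiffOn ℝ (⊤ : ℕ∞) F M ∧ (∀ x ∈ M, IsUnit (fderiv ℝ F x)) ∧
      ContDiffOn ℝ (⊤ : ℕ∞) Ξ Ω ∧ (∀ ξ ∈ Ω, IsUnit (fderiv ℝ Ξ ξ)) ∧
      ContDiffOn ℝ (⊤ : ℕ∞)
        (fun q : (Fin (n-1) → ℝ) × (Fin (n-1) → ℝ) => W q.1 q.2) (Ω ×ˢ V) ∧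
      0 < C ∧ IsCompact K ∧ K ⊆ Ω ×ˢ V ∧ K ∈ 𝓝[Ω ×ˢ V] (ξ₀, v₀) ∧
      ∀ q ∈ K, ∀ y ∈ F '' {z | ∃ t ∈ Icc (-1:ℝ) 1, z = toPt n (X q.1 q.2 t) t},
        ∃ w ∈ lineSet n (Ξ q.1) (W q.1 q.2), dist y w ≤ C * (dist q (ξ₀, v₀))^2 := by
  have hφs := hφ.1
  set q₀ : (Fin (n-1) → ℝ) × (Fin (n-1) → ℝ) := (ξ₀, v₀) with hq₀
  have h0 : (0 : ℝ) ∈ Icc (-1 : ℝ) 1 := by constructor <;> norm_num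
  have hxsm : ContDiffOn ℝ (⊤ : ℕ∞) (X ξ₀ v₀) (Icc (-1) 1) :=
    hXsm.comp (f := fun t : ℝ => (q₀, t)) (contDiff_prodMk_right q₀).contDiffOn
      fun t ht => ⟨⟨hξ₀, hv₀⟩, ht⟩
  have hγ := hXdef ξ₀ hξ₀ v₀ hv₀
  obtain ⟨D, z, θ, m, A, B, hD, hz, hθ, hDinj, hθd, hBdet, hcurve⟩ :=
    exists_straightening_data hn hMo hΩo hφ hB hξ₀ hxsm hγ
  -- The set of parameters is a neighbourhood of the base point.
  have hVnhds : V ∈ 𝓝 v₀ := by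
    have hp := hγ 0 h0
    have hstrict := (contDiffAt_gradXi_left hMo hΩo hφs hp.1 hξ₀).hasStrictFDerivAt (by simp)
    have hsurj : Function.Surjective (D 0) :=
      LinearMap.injective_iff_surjective (f := (D 0 : (Fin (n-1) → ℝ) →ₗ[ℝ] _)).1
        ((injective_iff_map_eq_zero _).2 (hDinj 0))
    have hmap := hstrict.map_nhds_eq_of_surj (LinearMap.range_eq_top.2 fun w => by
      obtain ⟨u, hu⟩ := hsurj w
      exact ⟨toPt n u 0, by rw [← hu, (hcurve 0 h0).2.1]; rfl⟩)
    rw [hp.2] at hmap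
    rw [← hmap, hV, Filter.mem_map]
    filter_upwards [hMo.mem_nhds hp.1] with p hpM using ⟨(p, ξ₀), ⟨hpM, hξ₀⟩, rfl⟩
  obtain ⟨r₁, hr₁, hball⟩ := nhds_basis_closedBall.mem_iff.1
    (prod_mem_nhds (hΩo.mem_nhds hξ₀) hVnhds)
  have hXlip : ∃ L : NNReal, LipschitzOnWith L
      (fun q : ((Fin (n-1) → ℝ) × (Fin (n-1) → ℝ)) × ℝ => X q.1.1 q.1.2 q.2)
      (closedBall q₀ r₁ ×ˢ Icc (-1 : ℝ) 1) :=
    LocallyLipschitzOn.exists_lipschitzOnWith_of_compact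
      ((isCompact_closedBall _ _).prod isCompact_Icc)
      (ContDiffOn.locallyLipschitzOn ((convex_closedBall _ _).prod (convex_Icc _ _))
        ((hXsm.of_le (by simp)).mono (prod_mono hball Subset.rfl)))
  obtain ⟨L, hL⟩ := hXlip
  have hXL : ∀ q ∈ closedBall q₀ r₁, ∀ t ∈ Icc (-1 : ℝ) 1,
      ‖X q.1 q.2 t - X ξ₀ v₀ t‖ ≤ L * dist q q₀ := by
    intro q hq t ht
    have := hL.dist_le_mul (q, t) ⟨hq, ht⟩ (q₀, t) ⟨mem_closedBall_self hr₁.le, ht⟩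
    rwa [dist_eq_norm, Prod.dist_eq, dist_self, max_eq_left dist_nonneg] at this
  -- The quadratic Taylor bound along the base curve.
  have hScont : ContinuousOn (fun t => (toPt n (X ξ₀ v₀ t) t, ξ₀)) (Icc (-1 : ℝ) 1) := by
    simp only [← toPtL_apply]
    exact ((toPtL n).continuous.comp_continuousOn
      (hxsm.continuousOn.prodMk continuousOn_id)).prodMk continuousOn_const
  obtain ⟨ε, hε, C, hC, hT⟩ := exists_taylor_bound (hMo.prod hΩo)
    ((contDiffOn_gradXi hMo hΩo hφs).of_le (WithTop.coe_le_coe.2 (le_top : (2 : ℕ∞) ≤ ⊤)))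
    (isCompact_Icc.image_of_continuousOn hScont)
    (by rintro _ ⟨t, ht, rfl⟩; exact ⟨(hγ t ht).1, hξ₀⟩)
  have hL1 : (0 : ℝ) < L + 1 := by positivity
  refine ⟨fun p => toPt n (v₀ + D (lastL n hn p) (headL n p - z (lastL n hn p)))
      (θ (lastL n hn p)),
    fun ξ => -(B.mulVec (ξ - ξ₀)), fun ξ v => v - A.mulVec (ξ - ξ₀),
    C * (L + 1) ^ 2 + 1, closedBall q₀ (min r₁ (ε / (L + 1))), ?_, ?_, ?_, ?_, ?_, ?_, ?_, ?_,
    ?_, ?_⟩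
  · simp only [← toPtL_apply]
    refine ContDiff.contDiffOn ((toPtL n).contDiff.comp (ContDiff.prodMk ?_
      (hθ.comp (lastL n hn).contDiff)))
    exact contDiff_const.add ((hD.comp (lastL n hn).contDiff).clm_apply
      ((headL n).contDiff.sub (hz.comp (lastL n hn).contDiff)))
  · exact fun p _ => isUnit_fderiv_fibrewise_affine hn hD hz hDinj hθd v₀ p
  · refine ContDiff.contDiffOn (ContDiff.neg ?_)
    exact (LinearMap.toContinuousLinearMap B.mulVecLin).contDiff.comp
      (contDiff_id.sub contDiff_const)
  · intro ξ _
    have hd : HasFDerivAt (fun ξ => -(B.mulVec (ξ - ξ₀)))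
        (-(LinearMap.toContinuousLinearMap B.mulVecLin)) ξ := by
      have := ((LinearMap.toContinuousLinearMap B.mulVecLin).hasFDerivAt.comp ξ
        ((hasFDerivAt_id (𝕜 := ℝ) ξ).sub_const ξ₀)).neg
      simpa using! this
    rw [hd.fderiv]
    have hBu := (Matrix.isUnit_iff_isUnit_det B).2 hBdet.isUnit
    exact IsUnit.neg (ContinuousLinearMap.isUnit_iff_bijective.2
      ⟨Matrix.mulVec_injective_iff_isUnit.2 hBu, Matrix.mulVec_surjective_iff_isUnit.2 hBu⟩)
  · refine ContDiff.contDiffOn (contDiff_snd.sub ?_)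
    exact (LinearMap.toContinuousLinearMap A.mulVecLin).contDiff.comp
      (contDiff_fst.sub contDiff_const)
  · positivity
  · exact isCompact_closedBall _ _
  · exact (closedBall_subset_closedBall (min_le_left _ _)).trans hball
  · exact mem_nhdsWithin_of_mem_nhds
      (closedBall_mem_nhds _ (lt_min hr₁ (div_pos hε hL1)))
  · rintro q hq _ ⟨_, ⟨t, ht, rfl⟩, rfl⟩
    have hq1 : q ∈ closedBall q₀ r₁ := closedBall_subset_closedBall (min_le_left _ _) hq
    have hqε : (L + 1) * dist q q₀ ≤ ε := by
      have := (mem_closedBall.1 hq).trans (min_le_right _ _)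
      rwa [le_div_iff₀ hL1, mul_comm] at this
    obtain ⟨hξ, hv⟩ := hball hq1
    have hδ := hXL q hq1 t ht
    have hη : ‖q.1 - ξ₀‖ ≤ dist q q₀ := by
      rw [← dist_eq_norm]; exact (le_max_left _ _ : _ ≤ max (dist q.1 ξ₀) (dist q.2 v₀))
    have hdist : ‖(toPt n (X q.1 q.2 t) t, q.1) - (toPt n (X ξ₀ v₀ t) t, ξ₀)‖
        ≤ (L + 1) * dist q q₀ := by
      rw [Prod.mk_sub_mk, toPt_sub_toPt, sub_self]
      refine max_le ((norm_toPt_zero_le n _).trans (hδ.trans ?_)) (hη.trans ?_)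
      · nlinarith [dist_nonneg (x := q) (y := q₀)]
      · nlinarith [dist_nonneg (x := q) (y := q₀), L.2, mul_nonneg L.2 (dist_nonneg (x := q) (y := q₀))]
    have hTq := hT _ ⟨t, ht, rfl⟩ (toPt n (X q.1 q.2 t) t, q.1)
      (by rw [dist_eq_norm]; exact hdist.trans hqε)
    obtain ⟨hz1, hD1, hA1⟩ := hcurve t ht
    refine ⟨_, ⟨-θ t, rfl⟩, ?_⟩
    simp only [lastL_toPt, headL_toPt, smul_toPt, toPt_sub_toPt, hz1]
    rw [dist_eq_norm, toPt_sub_toPt]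
    rw [Prod.mk_sub_mk, toPt_sub_toPt, sub_self, fderiv_gradXi_prod hMo hΩo hφs (hγ t ht).1 hξ₀,
      (hγ t ht).2, (hXdef q.1 hξ q.2 hv t ht).2, ← hD1, hA1, Matrix.add_mulVec,
      Matrix.smul_mulVec] at hTq
    have hlast : θ t - (0 - -θ t * 1) = 0 := by ring
    rw [hlast]
    refine (norm_toPt_zero_le n _).trans ?_
    rw [← norm_neg]
    refine (le_of_eq ?_).trans (hTq.trans ?_)
    · congr 1
      ext i
      simp
      ring
    · rw [Prod.mk_sub_mk, toPt_sub_toPt, sub_self] at hdist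
      calc C * _ ^ 2 ≤ C * ((L + 1) * dist q q₀) ^ 2 := by gcongr
        _ ≤ (C * (L + 1) ^ 2 + 1) * dist q q₀ ^ 2 := by nlinarith [sq_nonneg (dist q q₀)]
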